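/- Let n ≥ 2 and suppose (θ1,θ2) ∈ A ∪ B. Then the measure dμ = |x'|^{θ1}|x|^{θ2} dx is doubling: there exists a constant C = C(n,θ1,θ2) > 0 such that μ(B_{2R}(x̄)) ≤ C μ(B_R(x̄)) for every x̄ ∈ ℝ^n and every R > 0. -/

import Mathlib

open MeasureTheory Metric Set
open scoped ENNReal NNReal Topology

noncomputable section

/-- `ℝ^n` as a Euclidean space. -/
abbrev En (n : ℕ) := EuclideanSpace ℝ (Fin n)

/-- `|x'|`: the Euclidean norm of the first `n-1` coordinates of `x`. -/
def normPrime (n : ℕ) (x : En n) : ℝ :=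
  Real.sqrt (∑ i : Fin n, if (i : ℕ) + 1 < n then (x i) ^ 2 else 0)

/-- The anisotropic weight `w(x) = |x'|^θ1 * |x|^θ2`. -/
def weight (n : ℕ) (θ1 θ2 : ℝ) (x : En n) : ℝ :=
  normPrime n x ^ θ1 * ‖x‖ ^ θ2

/-- The measure `dμ = w dx` on `ℝ^n`. -/
def muW (n : ℕ) (θ1 θ2 : ℝ) : Measure (En n) :=
  (volume : Measure (En n)).withDensity fun x => ENNReal.ofReal (weight n θ1 θ2 x)

/-- The index set `𝒜 = {(a,b) : a > -(n-1), b ≥ 0}`. -/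
def setA (n : ℕ) : Set (ℝ × ℝ) := {p | -((n : ℝ) - 1) < p.1 ∧ 0 ≤ p.2}

/-- The index set `ℬ = {(a,b) : a > -(n-1), b < 0, a + b > -n}`. -/
def setB (n : ℕ) : Set (ℝ × ℝ) :=
  {p | -((n : ℝ) - 1) < p.1 ∧ p.2 < 0 ∧ -(n : ℝ) < p.1 + p.2}

/-- The index set `𝒞_q = {(a,b) : a < (n-1)(q-1), b ≤ 0}`. -/
def setC (n : ℕ) (q : ℝ) : Set (ℝ × ℝ) := {p | p.1 < ((n : ℝ) - 1) * (q - 1) ∧ p.2 ≤ 0}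

/-- The index set `𝒟_q = {(a,b) : a < (n-1)(q-1), b > 0, a+b < n(q-1)}`. -/
def setD (n : ℕ) (q : ℝ) : Set (ℝ × ℝ) :=
  {p | p.1 < ((n : ℝ) - 1) * (q - 1) ∧ 0 < p.2 ∧ p.1 + p.2 < (n : ℝ) * (q - 1)}

/-- The index set `ℱ = {(a,b) : a + b > -(n-1)}`. -/
def setF (n : ℕ) : Set (ℝ × ℝ) := {p | -((n : ℝ) - 1) < p.1 + p.2}

/-- Positive quantities that agree up to the factor `K` have comparable powers. -/
lemma rpow_le_of_comparable {K M t : ℝ} (θ : ℝ) (hK : 1 ≤ K) (hM : 0 < M) (ht : 0 < t)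
    (h₁ : t ≤ K * M) (h₂ : M ≤ K * t) : t ^ θ ≤ K ^ |θ| * M ^ θ := by
  have hK0 : 0 < K := by linarith
  rcases le_or_gt 0 θ with h | h
  · rw [abs_of_nonneg h, ← Real.mul_rpow hK0.le hM.le]
    exact Real.rpow_le_rpow ht.le h₁ h
  · rw [abs_of_neg h, Real.rpow_neg hK0.le, ← Real.inv_rpow hK0.le,
      ← Real.mul_rpow (inv_nonneg.2 hK0.le) hM.le]
    refine Real.rpow_le_rpow_of_nonpos (by positivity) ?_ h.le
    rw [inv_mul_le_iff₀ hK0]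
    exact h₂

lemma intervalIntegrable_abs_rpow {a : ℝ} (ha : -1 < a) (r : ℝ) :
    IntervalIntegrable (fun s : ℝ => |s| ^ a) volume 0 r := by
  rcases le_total 0 r with hr | hr
  · refine (intervalIntegral.intervalIntegrable_rpow' ha).congr fun s hs => ?_
    rw [uIoc_of_le hr] at hs
    simp [abs_of_pos hs.1]
  · rw [IntervalIntegrable.iff_comp_neg]
    refine (intervalIntegral.intervalIntegrable_rpow' ha).congr fun s hs => ?_
    rw [neg_zero, uIoc_of_le (by linarith)] at hs
    simp [abs_of_pos hs.1]

lemma integral_abs_rpow {a r : ℝ} (ha : -1 < a) (hr : 0 < r) :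
    ∫ s in (-r)..r, |s| ^ a = 2 * (r ^ (1 + a) / (1 + a)) := by
  have hpos : ∫ s in (0 : ℝ)..r, |s| ^ a = r ^ (1 + a) / (1 + a) := by
    rw [intervalIntegral.integral_congr (g := fun s => s ^ a), integral_rpow (Or.inl ha),
      Real.zero_rpow (by linarith), sub_zero, add_comm a 1]
    intro s hs
    rw [uIcc_of_le hr.le] at hs
    simp [abs_of_nonneg hs.1]
  have hneg : ∫ s in (-r)..0, |s| ^ a = r ^ (1 + a) / (1 + a) := by
    rw [← hpos, ← neg_zero, ← intervalIntegral.integral_comp_neg]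
    simp
  rw [← intervalIntegral.integral_add_adjacent_intervals (b := 0)
    (intervalIntegrable_abs_rpow ha _).symm (intervalIntegrable_abs_rpow ha _), hpos, hneg]
  ring

/-- A singular power is integrable on every interval, with a bound independent of the centre. -/
lemma integral_ball_abs_rpow_le {a : ℝ} (ha : -1 < a) (ha0 : a ≤ 0) (t : ℝ) {r : ℝ} (hr : 0 < r) :
    IntegrableOn (fun s : ℝ => |s| ^ a) (ball t r) ∧
      ∫ s in ball t r, |s| ^ a ≤ (2 / (1 + a) + 2) * r ^ (1 + a) := by
  have hnear : IntegrableOn (fun s : ℝ => |s| ^ a) (Ioc (-r) r) :=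
    (intervalIntegrable_iff_integrableOn_Ioc_of_le (by linarith)).1
      ((intervalIntegrable_abs_rpow ha _).symm.trans (intervalIntegrable_abs_rpow ha _))
  have hind : Integrable ((Ioc (-r) r).indicator fun s : ℝ => |s| ^ a) :=
    (integrable_indicator_iff measurableSet_Ioc).2 hnear
  have hconst : IntegrableOn (fun _ : ℝ => r ^ a) (ball t r) :=
    integrableOn_const measure_ball_lt_top.ne
  have hle : ∀ s : ℝ, |s| ^ a ≤ (Ioc (-r) r).indicator (fun s : ℝ => |s| ^ a) s + r ^ a := by
    intro s
    by_cases hs : s ∈ Ioc (-r) r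
    · rw [indicator_of_mem hs]
      have : 0 ≤ r ^ a := by positivity
      linarith
    · rw [indicator_of_notMem hs, zero_add]
      refine Real.rpow_le_rpow_of_nonpos hr ?_ ha0
      by_contra! h
      exact hs ⟨(abs_lt.1 h).1, (abs_lt.1 h).2.le⟩
  have hsum := hind.integrableOn (s := ball t r) |>.add hconst
  have hint : IntegrableOn (fun s : ℝ => |s| ^ a) (ball t r) := by
    refine hsum.mono' (Measurable.aestronglyMeasurable (by fun_prop)) (ae_of_all _ fun s => ?_)
    rw [Real.norm_of_nonneg (by positivity)]
    exact hle s
  refine ⟨hint, ?_⟩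
  calc ∫ s in ball t r, |s| ^ a
      ≤ ∫ s in ball t r, ((Ioc (-r) r).indicator (fun s : ℝ => |s| ^ a) s + r ^ a) :=
        integral_mono hint hsum hle
    _ = (∫ s in ball t r, (Ioc (-r) r).indicator (fun s : ℝ => |s| ^ a) s)
          + ∫ s in ball t r, r ^ a := integral_add hind.integrableOn hconst
    _ ≤ (∫ s, (Ioc (-r) r).indicator (fun s : ℝ => |s| ^ a) s) + ∫ s in ball t r, r ^ a := by
        refine add_le_add_left (setIntegral_le_integral hind (ae_of_all _ fun s => ?_)) _
        exact indicator_nonneg (fun s _ => by positivity) s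
    _ = (2 / (1 + a) + 2) * r ^ (1 + a) := by
        rw [integral_indicator measurableSet_Ioc, ← intervalIntegral.integral_of_le (by linarith),
          integral_abs_rpow ha hr, setIntegral_const, Real.rpow_add hr, Real.rpow_one]
        simp only [Measure.real, Real.volume_ball, smul_eq_mul]
        rw [ENNReal.toReal_ofReal (by positivity)]
        ring

/-- On balls of radius `r`, a product of singular powers of the coordinates has integral
controlled by the homogeneous power of `r`, uniformly in the centre. -/
lemma lintegral_ball_prod_abs_rpow_le {n : ℕ} (a : Fin n → ℝ) (ha : ∀ i, -1 < a i)
    (ha0 : ∀ i, a i ≤ 0) :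
    ∃ C : ℝ, 0 < C ∧ ∀ (c : En n) (r : ℝ), 0 < r →
      ∫⁻ x in ball c r, ENNReal.ofReal (∏ i, |x i| ^ a i)
        ≤ ENNReal.ofReal (C * r ^ ((n : ℝ) + ∑ i, a i)) := by
  have hfac : ∀ i, 0 < 2 / (1 + a i) + 2 := fun i => by
    have : 0 < 1 + a i := by linarith [ha i]
    positivity
  refine ⟨∏ i, (2 / (1 + a i) + 2), Finset.prod_pos fun i _ => hfac i, fun c r hr => ?_⟩
  have hsub : ball c r ⊆ (WithLp.ofLp : En n → (Fin n → ℝ)) ⁻¹'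
      (univ.pi fun i => ball (c i) r) := by
    intro x hx i _
    rw [mem_ball, dist_eq_norm] at hx ⊢
    exact (PiLp.norm_apply_le (x - c) i).trans_lt hx
  have hint : Integrable (fun x : Fin n → ℝ => ∏ i, |x i| ^ a i)
      (Measure.pi fun i => volume.restrict (ball (c i) r)) :=
    Integrable.fintype_prod_dep fun i => (integral_ball_abs_rpow_le (ha i) (ha0 i) (c i) hr).1
  calc ∫⁻ x in ball c r, ENNReal.ofReal (∏ i, |x i| ^ a i)
      ≤ ∫⁻ x in (WithLp.ofLp : En n → (Fin n → ℝ)) ⁻¹' (univ.pi fun i => ball (c i) r),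
          ENNReal.ofReal (∏ i, |x i| ^ a i) := lintegral_mono_set hsub
    _ = ∫⁻ x in univ.pi fun i => ball (c i) r, ENNReal.ofReal (∏ i, |x i| ^ a i) :=
        (PiLp.volume_preserving_ofLp (Fin n)).setLIntegral_comp_preimage
          (MeasurableSet.univ_pi fun i => measurableSet_ball)
          (f := fun x : Fin n → ℝ => ENNReal.ofReal (∏ i, |x i| ^ a i)) (by fun_prop)
    _ = ENNReal.ofReal (∏ i, ∫ s in ball (c i) r, |s| ^ a i) := by
        rw [volume_pi, Measure.restrict_pi_pi,
          ← ofReal_integral_eq_lintegral_ofReal hint (ae_of_all _ fun x => by positivity),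
          integral_fintype_prod_eq_prod (fun i (s : ℝ) => |s| ^ a i)]
    _ ≤ ENNReal.ofReal (∏ i, ((2 / (1 + a i) + 2) * r ^ (1 + a i))) := by
        refine ENNReal.ofReal_le_ofReal (Finset.prod_le_prod (fun i _ => ?_) fun i _ =>
          (integral_ball_abs_rpow_le (ha i) (ha0 i) (c i) hr).2)
        exact integral_nonneg fun s => by positivity
    _ = _ := by
        rw [Finset.prod_mul_distrib, ← Real.rpow_sum_of_pos hr, Finset.sum_add_distrib]
        simp

/-- The orthogonal projection killing the last coordinate. -/
def zeroLast (n : ℕ) : En n →ₗ[ℝ] En n where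
  toFun x := WithLp.toLp 2 fun i => if (i : ℕ) + 1 < n then x i else 0
  map_add' x y := by ext i; by_cases h : (i : ℕ) + 1 < n <;> simp [h]
  map_smul' c x := by ext i; by_cases h : (i : ℕ) + 1 < n <;> simp [h]

lemma zeroLast_apply {n : ℕ} (x : En n) (i : Fin n) :
    zeroLast n x i = if (i : ℕ) + 1 < n then x i else 0 := rfl

lemma normPrime_eq_norm {n : ℕ} (x : En n) : normPrime n x = ‖zeroLast n x‖ := by
  rw [normPrime, EuclideanSpace.norm_eq]
  congr 1
  refine Finset.sum_congr rfl fun i _ => ?_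
  rw [zeroLast_apply]
  split_ifs <;> simp

lemma normPrime_nonneg {n : ℕ} (x : En n) : 0 ≤ normPrime n x := Real.sqrt_nonneg _

lemma normPrime_le_norm {n : ℕ} (x : En n) : normPrime n x ≤ ‖x‖ := by
  rw [normPrime, EuclideanSpace.norm_eq]
  refine Real.sqrt_le_sqrt (Finset.sum_le_sum fun i _ => ?_)
  split_ifs
  · simp
  · positivity

lemma abs_normPrime_sub_le {n : ℕ} (x y : En n) :
    |normPrime n x - normPrime n y| ≤ ‖x - y‖ := by
  rw [normPrime_eq_norm, normPrime_eq_norm]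
  refine (abs_norm_sub_norm_le _ _).trans ?_
  rw [← map_sub, ← normPrime_eq_norm]
  exact normPrime_le_norm _

lemma abs_castSucc_le_normPrime {m : ℕ} (x : En (m + 1)) (i : Fin m) :
    |x i.castSucc| ≤ normPrime (m + 1) x := by
  rw [normPrime_eq_norm]
  simpa [zeroLast_apply] using PiLp.norm_apply_le (zeroLast (m + 1) x) i.castSucc

lemma normPrime_pos {m : ℕ} (hm : 1 ≤ m) {x : En (m + 1)} (hx : ∀ i, x i ≠ 0) :
    0 < normPrime (m + 1) x :=
  (abs_pos.2 (hx _)).trans_le (abs_castSucc_le_normPrime x ⟨0, hm⟩)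

lemma ae_coord_ne_zero (n : ℕ) : ∀ᵐ x : En n, ∀ i, x i ≠ 0 := by
  rw [ae_all_iff]
  intro i
  have hpi : ∀ᵐ y : Fin n → ℝ, y i ≠ 0 :=
    (Measure.quasiMeasurePreserving_eval (fun _ : Fin n => (volume : Measure ℝ)) i).ae
      (Measure.ae_ne volume 0)
  exact (PiLp.volume_preserving_ofLp (Fin n)).quasiMeasurePreserving.ae hpi

/-- Negative powers of `|x'|` are dominated by products of powers of the coordinates. -/
lemma normPrime_rpow_neg_mul_le {m : ℕ} (hm : 1 ≤ m) {q β : ℝ} (hq : 0 ≤ q) {x : En (m + 1)}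
    (hx : ∀ i, x i ≠ 0) :
    normPrime (m + 1) x ^ (-q) * |x (Fin.last m)| ^ (-β) ≤
      ∏ i, |x i| ^ (if (i : ℕ) + 1 < m + 1 then -(q / m) else -β) := by
  have hm' : (0 : ℝ) < m := by exact_mod_cast hm
  rw [Fin.prod_univ_castSucc]
  simp only [Fin.val_castSucc, Fin.val_last, add_lt_add_iff_right, Fin.is_lt, lt_irrefl, if_true,
    if_false]
  gcongr
  have hsplit : normPrime (m + 1) x ^ (-q)
      = ∏ _i : Fin m, normPrime (m + 1) x ^ (-(q / m)) := by
    rw [Finset.prod_const, Finset.card_univ, Fintype.card_fin, ← Real.rpow_mul_natCast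
      (normPrime_nonneg x)]
    congr 1
    field_simp
  rw [hsplit]
  refine Finset.prod_le_prod (fun i _ => Real.rpow_nonneg (normPrime_nonneg x) _) fun i _ => ?_
  exact Real.rpow_le_rpow_of_nonpos (abs_pos.2 (hx _)) (abs_castSucc_le_normPrime x i)
    (neg_nonpos.2 (by positivity))

lemma lintegral_ball_rpow_neg_le {m : ℕ} (hm : 1 ≤ m) {q β : ℝ} (hq : 0 ≤ q) (hqm : q < m)
    (hβ : 0 ≤ β) (hβ1 : β < 1) :
    ∃ C : ℝ, 0 < C ∧ ∀ (c : En (m + 1)) (r : ℝ), 0 < r →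
      ∫⁻ x in ball c r, ENNReal.ofReal (normPrime (m + 1) x ^ (-q) * |x (Fin.last m)| ^ (-β))
        ≤ ENNReal.ofReal (C * r ^ ((m : ℝ) + 1 - q - β)) := by
  have hm' : (0 : ℝ) < m := by exact_mod_cast hm
  obtain ⟨C, hC, h⟩ := lintegral_ball_prod_abs_rpow_le
    (fun i : Fin (m + 1) => if (i : ℕ) + 1 < m + 1 then -(q / m) else -β)
    (fun i => by
      split_ifs
      · exact neg_lt_neg ((div_lt_one hm').2 hqm)
      · exact neg_lt_neg hβ1)
    (fun i => by
      split_ifs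
      · exact neg_nonpos.2 (by positivity)
      · exact neg_nonpos.2 hβ)
  refine ⟨C, hC, fun c r hr => ?_⟩
  have hexp : ((m + 1 : ℕ) : ℝ) +
      ∑ i : Fin (m + 1), (if (i : ℕ) + 1 < m + 1 then -(q / m) else -β) = m + 1 - q - β := by
    rw [Fin.sum_univ_castSucc]
    simp
    field_simp
    ring
  rw [← hexp]
  refine le_trans (lintegral_mono_ae ?_) (h c r hr)
  filter_upwards [ae_restrict_of_ae (ae_coord_ne_zero (m + 1))] with x hx
  exact ENNReal.ofReal_le_ofReal (normPrime_rpow_neg_mul_le hm hq hx)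

/-- Integral of a power weight over balls whose centre is within twice the radius of the axis. -/
lemma lintegral_ball_normPrime_rpow_le {m : ℕ} (hm : 1 ≤ m) {γ β : ℝ} (hγ : -(m : ℝ) < γ)
    (hβ : 0 ≤ β) (hβ1 : β < 1) :
    ∃ C : ℝ, 0 < C ∧ ∀ (c : En (m + 1)) (r : ℝ), 0 < r → normPrime (m + 1) c ≤ 2 * r →
      ∫⁻ x in ball c r, ENNReal.ofReal (normPrime (m + 1) x ^ γ * |x (Fin.last m)| ^ (-β))
        ≤ ENNReal.ofReal (C * r ^ ((m : ℝ) + 1 + γ - β)) := by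
  have hm' : (0 : ℝ) < m := by exact_mod_cast hm
  obtain ⟨C, hC, h⟩ := lintegral_ball_rpow_neg_le hm (q := max (-γ) 0) (le_max_right _ _)
    (max_lt (by linarith) hm') hβ hβ1
  have hsplit : γ = max γ 0 - max (-γ) 0 := by
    rcases le_total 0 γ with h0 | h0
    · rw [max_eq_left h0, max_eq_right (by linarith)]; ring
    · rw [max_eq_right h0, max_eq_left (by linarith)]; ring
  set p := max γ 0
  set q := max (-γ) 0
  have hp0 : 0 ≤ p := le_max_right _ _
  refine ⟨3 ^ p * C, by positivity, fun c r hr hc => ?_⟩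
  calc ∫⁻ x in ball c r, ENNReal.ofReal (normPrime (m + 1) x ^ γ * |x (Fin.last m)| ^ (-β))
      ≤ ∫⁻ x in ball c r, ENNReal.ofReal ((3 * r) ^ p) *
          ENNReal.ofReal (normPrime (m + 1) x ^ (-q) * |x (Fin.last m)| ^ (-β)) := by
        refine lintegral_mono_ae ?_
        filter_upwards [ae_restrict_mem measurableSet_ball,
          ae_restrict_of_ae (ae_coord_ne_zero (m + 1))] with x hxb hx
        have hpos := normPrime_pos hm hx
        rw [← ENNReal.ofReal_mul (by positivity), ← mul_assoc]
        refine ENNReal.ofReal_le_ofReal ?_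
        rw [hsplit, sub_eq_add_neg, Real.rpow_add hpos]
        rw [mem_ball, dist_eq_norm] at hxb
        gcongr
        linarith [(abs_le.1 (abs_normPrime_sub_le x c)).2]
    _ = ENNReal.ofReal ((3 * r) ^ p) * ∫⁻ x in ball c r,
          ENNReal.ofReal (normPrime (m + 1) x ^ (-q) * |x (Fin.last m)| ^ (-β)) :=
        lintegral_const_mul' _ _ ENNReal.ofReal_ne_top
    _ ≤ ENNReal.ofReal ((3 * r) ^ p) * ENNReal.ofReal (C * r ^ ((m : ℝ) + 1 - q - β)) := by
        gcongr
        exact h c r hr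
    _ = _ := by
        rw [← ENNReal.ofReal_mul (by positivity), Real.mul_rpow (by norm_num) hr.le,
          show (m : ℝ) + 1 + γ - β = p + (m + 1 - q - β) by rw [hsplit]; ring, Real.rpow_add hr]
        ring_nf

/-- The size of `muW` on a ball of radius `r` centred at `c`, up to a multiplicative constant. -/
def ballSize (n : ℕ) (θ1 θ2 : ℝ) (c : En n) (r : ℝ) : ℝ :=
  r ^ n * (normPrime n c + r) ^ θ1 * (‖c‖ + r) ^ θ2

lemma ballSize_nonneg {n : ℕ} (θ1 θ2 : ℝ) (c : En n) {r : ℝ} (hr : 0 < r) :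
    0 ≤ ballSize n θ1 θ2 c r := by
  have := normPrime_nonneg c
  unfold ballSize
  positivity

lemma muW_ball (n : ℕ) (θ1 θ2 : ℝ) (c : En n) (r : ℝ) :
    muW n θ1 θ2 (ball c r) = ∫⁻ x in ball c r, ENNReal.ofReal (weight n θ1 θ2 x) :=
  withDensity_apply _ measurableSet_ball

lemma exists_volume_ball (m : ℕ) :
    ∃ v : ℝ, 0 < v ∧ ∀ (c : En (m + 1)) (r : ℝ), 0 < r →
      volume (ball c r) = ENNReal.ofReal (r ^ (m + 1) * v) := by
  have htop : volume (ball (0 : En (m + 1)) 1) ≠ ∞ := measure_ball_lt_top.ne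
  refine ⟨(volume (ball (0 : En (m + 1)) 1)).toReal,
    ENNReal.toReal_pos (measure_ball_pos _ _ one_pos).ne' htop, fun c r hr => ?_⟩
  rw [Measure.addHaar_ball_of_pos _ _ hr, ENNReal.ofReal_mul (by positivity),
    ENNReal.ofReal_toReal htop, finrank_euclideanSpace, Fintype.card_fin]

/-- Splitting of the singularity of `|x|^θ2` between `|x'|` and the last coordinate. -/
lemma exists_exponent_split {m : ℕ} {θ1 θ2 : ℝ} (h1 : -(m : ℝ) < θ1)
    (h2 : 0 ≤ θ2 ∨ -((m : ℝ) + 1) < θ1 + θ2) :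
    ∃ p α β : ℝ, 0 ≤ p ∧ 0 ≤ α ∧ 0 ≤ β ∧ β < 1 ∧ θ2 = p + -α + -β ∧ -(m : ℝ) < θ1 - α := by
  rcases le_or_gt 0 θ2 with h | h
  · exact ⟨θ2, 0, 0, h, le_rfl, le_rfl, one_pos, by ring, by linarith⟩
  · have hsum : -((m : ℝ) + 1) < θ1 + θ2 := h2.resolve_left (not_le.2 h)
    have hP : 0 < θ1 + m := by linarith
    have hlt : -θ2 / (θ1 + m + 1) < 1 := (div_lt_one (by linarith)).2 (by linarith)
    have hnn : 0 ≤ -θ2 / (θ1 + m + 1) := div_nonneg (by linarith) (by linarith)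
    refine ⟨0, (θ1 + m) * (-θ2 / (θ1 + m + 1)), -θ2 / (θ1 + m + 1), le_rfl,
      by positivity, hnn, hlt, ?_, by nlinarith⟩
    field_simp
    ring

lemma muW_ball_le_of_near_origin {m : ℕ} (hm : 1 ≤ m) {θ1 θ2 : ℝ} (h1 : -(m : ℝ) < θ1)
    (h2 : 0 ≤ θ2 ∨ -((m : ℝ) + 1) < θ1 + θ2) :
    ∃ C : ℝ, 0 < C ∧ ∀ (c : En (m + 1)) (r : ℝ), 0 < r → ‖c‖ ≤ 2 * r →
      muW (m + 1) θ1 θ2 (ball c r) ≤ ENNReal.ofReal (C * ballSize (m + 1) θ1 θ2 c r) := by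
  obtain ⟨p, α, β, hp, hα, hβ, hβ1, hθ2, hγ⟩ := exists_exponent_split h1 h2
  obtain ⟨C, hC, h⟩ := lintegral_ball_normPrime_rpow_le hm hγ hβ hβ1
  refine ⟨3 ^ p * C * 3 ^ |θ1| * 3 ^ |θ2|, by positivity, fun c r hr hc => ?_⟩
  have hN := normPrime_nonneg c
  have hNc := normPrime_le_norm c
  rw [muW_ball]
  calc ∫⁻ x in ball c r, ENNReal.ofReal (weight (m + 1) θ1 θ2 x)
      ≤ ∫⁻ x in ball c r, ENNReal.ofReal ((3 * r) ^ p) * ENNReal.ofReal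
          (normPrime (m + 1) x ^ (θ1 - α) * |x (Fin.last m)| ^ (-β)) := by
        refine lintegral_mono_ae ?_
        filter_upwards [ae_restrict_mem measurableSet_ball,
          ae_restrict_of_ae (ae_coord_ne_zero (m + 1))] with x hxb hx
        have hpos := normPrime_pos hm hx
        have hle := normPrime_le_norm x
        have hxpos : 0 < ‖x‖ := hpos.trans_le hle
        rw [mem_ball, dist_eq_norm] at hxb
        rw [← ENNReal.ofReal_mul (by positivity)]
        refine ENNReal.ofReal_le_ofReal ?_
        have e1 : ‖x‖ ^ p ≤ (3 * r) ^ p :=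
          Real.rpow_le_rpow hxpos.le (by linarith [norm_sub_norm_le x c]) hp
        have e2 : ‖x‖ ^ (-α) ≤ normPrime (m + 1) x ^ (-α) :=
          Real.rpow_le_rpow_of_nonpos hpos hle (by linarith)
        have e3 : ‖x‖ ^ (-β) ≤ |x (Fin.last m)| ^ (-β) :=
          Real.rpow_le_rpow_of_nonpos (abs_pos.2 (hx _)) (PiLp.norm_apply_le x _) (by linarith)
        calc weight (m + 1) θ1 θ2 x
            = normPrime (m + 1) x ^ θ1 * (‖x‖ ^ p * ‖x‖ ^ (-α) * ‖x‖ ^ (-β)) := by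
              rw [weight, hθ2, Real.rpow_add hxpos, Real.rpow_add hxpos]
          _ ≤ normPrime (m + 1) x ^ θ1 * ((3 * r) ^ p * normPrime (m + 1) x ^ (-α) *
                |x (Fin.last m)| ^ (-β)) := by gcongr
          _ = _ := by rw [sub_eq_add_neg, Real.rpow_add hpos]; ring
    _ = ENNReal.ofReal ((3 * r) ^ p) * ∫⁻ x in ball c r, ENNReal.ofReal
          (normPrime (m + 1) x ^ (θ1 - α) * |x (Fin.last m)| ^ (-β)) :=
        lintegral_const_mul' _ _ ENNReal.ofReal_ne_top
    _ ≤ ENNReal.ofReal ((3 * r) ^ p) *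
          ENNReal.ofReal (C * r ^ ((m : ℝ) + 1 + (θ1 - α) - β)) := by
        gcongr
        exact h c r hr (by linarith)
    _ = ENNReal.ofReal (3 ^ p * C * (r ^ (m + 1) * r ^ θ1 * r ^ θ2)) := by
        rw [← ENNReal.ofReal_mul (by positivity), Real.mul_rpow (by norm_num) hr.le,
          ← Real.rpow_natCast r (m + 1), ← Real.rpow_add hr, ← Real.rpow_add hr,
          show ((m + 1 : ℕ) : ℝ) + θ1 + θ2 = p + (m + 1 + (θ1 - α) - β) by
            push_cast; rw [hθ2]; ring, Real.rpow_add hr p]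
        ring_nf
    _ ≤ _ := by
        refine ENNReal.ofReal_le_ofReal ?_
        have e1 : r ^ θ1 ≤ 3 ^ |θ1| * (normPrime (m + 1) c + r) ^ θ1 :=
          rpow_le_of_comparable θ1 (by norm_num) (by linarith) hr (by linarith) (by linarith)
        have e2 : r ^ θ2 ≤ 3 ^ |θ2| * (‖c‖ + r) ^ θ2 :=
          rpow_le_of_comparable θ2 (by norm_num) (by linarith) hr (by linarith) (by linarith)
        calc 3 ^ p * C * (r ^ (m + 1) * r ^ θ1 * r ^ θ2)
            ≤ 3 ^ p * C * (r ^ (m + 1) * (3 ^ |θ1| * (normPrime (m + 1) c + r) ^ θ1) *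
                (3 ^ |θ2| * (‖c‖ + r) ^ θ2)) := by gcongr
          _ = _ := by rw [ballSize]; ring

lemma norm_rpow_le_of_mem_ball {n : ℕ} (θ : ℝ) {c x : En n} {r : ℝ} (hr : 0 < r)
    (hc : 2 * r ≤ ‖c‖) (hx : x ∈ ball c r) : ‖x‖ ^ θ ≤ 3 ^ |θ| * (‖c‖ + r) ^ θ := by
  rw [mem_ball, dist_eq_norm] at hx
  have := abs_le.1 (abs_norm_sub_norm_le x c)
  exact rpow_le_of_comparable θ (by norm_num) (by linarith) (by linarith) (by linarith)
    (by linarith)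

lemma normPrime_rpow_le_of_mem_ball {n : ℕ} (θ : ℝ) {c x : En n} {r : ℝ} (hr : 0 < r)
    (hc : 2 * r ≤ normPrime n c) (hx : x ∈ ball c r) :
    normPrime n x ^ θ ≤ 3 ^ |θ| * (normPrime n c + r) ^ θ := by
  rw [mem_ball, dist_eq_norm] at hx
  have := abs_le.1 (abs_normPrime_sub_le x c)
  exact rpow_le_of_comparable θ (by norm_num) (by linarith) (by linarith) (by linarith)
    (by linarith)

lemma muW_ball_le_of_near_axis {m : ℕ} (hm : 1 ≤ m) {θ1 : ℝ} (θ2 : ℝ) (h1 : -(m : ℝ) < θ1) :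
    ∃ C : ℝ, 0 < C ∧ ∀ (c : En (m + 1)) (r : ℝ), 0 < r → 2 * r ≤ ‖c‖ →
      normPrime (m + 1) c ≤ 2 * r →
      muW (m + 1) θ1 θ2 (ball c r) ≤ ENNReal.ofReal (C * ballSize (m + 1) θ1 θ2 c r) := by
  obtain ⟨C, hC, h⟩ := lintegral_ball_normPrime_rpow_le hm h1 le_rfl one_pos
  refine ⟨C * 3 ^ |θ1| * 3 ^ |θ2|, by positivity, fun c r hr hc hc' => ?_⟩
  have hN := normPrime_nonneg c
  rw [muW_ball]
  calc ∫⁻ x in ball c r, ENNReal.ofReal (weight (m + 1) θ1 θ2 x)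
      ≤ ∫⁻ x in ball c r, ENNReal.ofReal (3 ^ |θ2| * (‖c‖ + r) ^ θ2) * ENNReal.ofReal
          (normPrime (m + 1) x ^ θ1 * |x (Fin.last m)| ^ (-0 : ℝ)) := by
        refine setLIntegral_mono' measurableSet_ball fun x hx => ?_
        rw [← ENNReal.ofReal_mul (by positivity), neg_zero, Real.rpow_zero, mul_one, weight,
          mul_comm]
        exact ENNReal.ofReal_le_ofReal (mul_le_mul_of_nonneg_right
          (norm_rpow_le_of_mem_ball θ2 hr hc hx) (Real.rpow_nonneg (normPrime_nonneg x) _))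
    _ = ENNReal.ofReal (3 ^ |θ2| * (‖c‖ + r) ^ θ2) * ∫⁻ x in ball c r, ENNReal.ofReal
          (normPrime (m + 1) x ^ θ1 * |x (Fin.last m)| ^ (-0 : ℝ)) :=
        lintegral_const_mul' _ _ ENNReal.ofReal_ne_top
    _ ≤ ENNReal.ofReal (3 ^ |θ2| * (‖c‖ + r) ^ θ2) *
          ENNReal.ofReal (C * r ^ ((m : ℝ) + 1 + θ1 - 0)) := by
        gcongr
        exact h c r hr hc'
    _ = ENNReal.ofReal (C * 3 ^ |θ2| * (‖c‖ + r) ^ θ2 * (r ^ (m + 1) * r ^ θ1)) := by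
        rw [← ENNReal.ofReal_mul (by positivity), ← Real.rpow_natCast r (m + 1),
          ← Real.rpow_add hr]
        push_cast
        ring_nf
    _ ≤ _ := by
        refine ENNReal.ofReal_le_ofReal ?_
        have e1 : r ^ θ1 ≤ 3 ^ |θ1| * (normPrime (m + 1) c + r) ^ θ1 :=
          rpow_le_of_comparable θ1 (by norm_num) (by linarith) hr (by linarith) (by linarith)
        calc C * 3 ^ |θ2| * (‖c‖ + r) ^ θ2 * (r ^ (m + 1) * r ^ θ1)
            ≤ C * 3 ^ |θ2| * (‖c‖ + r) ^ θ2 *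
                (r ^ (m + 1) * (3 ^ |θ1| * (normPrime (m + 1) c + r) ^ θ1)) := by gcongr
          _ = _ := by rw [ballSize]; ring

lemma muW_ball_le_of_far_from_axis (m : ℕ) (θ1 θ2 : ℝ) :
    ∃ C : ℝ, 0 < C ∧ ∀ (c : En (m + 1)) (r : ℝ), 0 < r → 2 * r ≤ normPrime (m + 1) c →
      muW (m + 1) θ1 θ2 (ball c r) ≤ ENNReal.ofReal (C * ballSize (m + 1) θ1 θ2 c r) := by
  obtain ⟨v, hv, hvol⟩ := exists_volume_ball m
  refine ⟨3 ^ |θ1| * 3 ^ |θ2| * v, by positivity, fun c r hr hc => ?_⟩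
  have hN := normPrime_nonneg c
  have hc' := hc.trans (normPrime_le_norm c)
  rw [muW_ball]
  calc ∫⁻ x in ball c r, ENNReal.ofReal (weight (m + 1) θ1 θ2 x)
      ≤ ∫⁻ _x in ball c r, ENNReal.ofReal ((3 ^ |θ1| * (normPrime (m + 1) c + r) ^ θ1) *
          (3 ^ |θ2| * (‖c‖ + r) ^ θ2)) := by
        refine setLIntegral_mono' measurableSet_ball fun x hx => ENNReal.ofReal_le_ofReal ?_
        exact mul_le_mul (normPrime_rpow_le_of_mem_ball θ1 hr hc hx)
          (norm_rpow_le_of_mem_ball θ2 hr hc' hx) (by positivity) (by positivity)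
    _ = _ := by
        rw [setLIntegral_const, hvol c r hr, ← ENNReal.ofReal_mul (by positivity), ballSize]
        ring_nf

lemma muW_ball_le {m : ℕ} (hm : 1 ≤ m) {θ1 θ2 : ℝ} (h1 : -(m : ℝ) < θ1)
    (h2 : 0 ≤ θ2 ∨ -((m : ℝ) + 1) < θ1 + θ2) :
    ∃ C : ℝ, 0 < C ∧ ∀ (c : En (m + 1)) (r : ℝ), 0 < r →
      muW (m + 1) θ1 θ2 (ball c r) ≤ ENNReal.ofReal (C * ballSize (m + 1) θ1 θ2 c r) := by
  obtain ⟨C₁, hC₁, near_origin⟩ := muW_ball_le_of_near_origin hm h1 h2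
  obtain ⟨C₂, hC₂, near_axis⟩ := muW_ball_le_of_near_axis hm θ2 h1
  obtain ⟨C₃, hC₃, far⟩ := muW_ball_le_of_far_from_axis m θ1 θ2
  refine ⟨C₁ + C₂ + C₃, by positivity, fun c r hr => ?_⟩
  have hS := ballSize_nonneg θ1 θ2 c hr
  have hmono : ∀ C ≤ C₁ + C₂ + C₃, ENNReal.ofReal (C * ballSize (m + 1) θ1 θ2 c r) ≤
      ENNReal.ofReal ((C₁ + C₂ + C₃) * ballSize (m + 1) θ1 θ2 c r) := fun C hC =>
    ENNReal.ofReal_le_ofReal (mul_le_mul_of_nonneg_right hC hS)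
  rcases le_total ‖c‖ (2 * r) with hc | hc
  · exact (near_origin c r hr hc).trans (hmono _ (by linarith))
  rcases le_total (normPrime (m + 1) c) (2 * r) with hc' | hc'
  · exact (near_axis c r hr hc hc').trans (hmono _ (by linarith))
  · exact (far c r hr hc').trans (hmono _ (by linarith))

/-- Vectors at an acute angle do not cancel. -/
lemma two_thirds_mul_le_norm_add {E : Type*} [NormedAddCommGroup E] [InnerProductSpace ℝ E]
    {v w : E} (h : 0 ≤ inner ℝ v w) : 2 / 3 * (‖v‖ + ‖w‖) ≤ ‖v + w‖ := by
  have hsq : ‖v + w‖ ^ 2 = ‖v‖ ^ 2 + 2 * inner ℝ v w + ‖w‖ ^ 2 := norm_add_sq_real v w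
  refine le_of_sq_le_sq ?_ (norm_nonneg _)
  nlinarith [sq_nonneg (‖v‖ - ‖w‖), sq_nonneg (‖v‖ + ‖w‖)]

/-- A ball of radius `R` contains a ball of radius `R / 8` on which `|x'|` and `|x|` are as large
as `R` allows. -/
lemma exists_ball_comparable {m : ℕ} (hm : 1 ≤ m) (c : En (m + 1)) {R : ℝ} (hR : 0 < R) :
    ∃ y : En (m + 1), ball y (R / 8) ⊆ ball c R ∧ ∀ x ∈ ball y (R / 8),
      normPrime (m + 1) c + R ≤ 5 * normPrime (m + 1) x ∧ ‖c‖ + R ≤ 5 * ‖x‖ := by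
  obtain ⟨s, hs, hsc⟩ : ∃ s : ℝ, |s| = R / 2 ∧ 0 ≤ s * c 0 := by
    rcases le_total 0 (c 0) with h | h
    · exact ⟨R / 2, abs_of_pos (by positivity), by positivity⟩
    · exact ⟨-(R / 2), by rw [abs_neg, abs_of_pos (by positivity)], by nlinarith⟩
  set w : En (m + 1) := EuclideanSpace.single 0 s with hw
  have hwn : ‖w‖ = R / 2 := by rw [hw, PiLp.norm_single, Real.norm_eq_abs, hs]
  have hzw : zeroLast (m + 1) w = w := by
    ext i
    rw [zeroLast_apply]
    split_ifs with hi
    · rfl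
    · have : i ≠ 0 := by rintro rfl; simp at hi; omega
      simp [hw, this]
  have hy : 2 / 3 * (‖c‖ + R / 2) ≤ ‖c + w‖ := by
    rw [← hwn]
    refine two_thirds_mul_le_norm_add ?_
    rw [hw, EuclideanSpace.inner_single_right]
    simpa using hsc
  have hy' : 2 / 3 * (normPrime (m + 1) c + R / 2) ≤ normPrime (m + 1) (c + w) := by
    rw [normPrime_eq_norm, normPrime_eq_norm, map_add, hzw, ← hwn]
    refine two_thirds_mul_le_norm_add ?_
    have hm0 : 0 < m := hm
    rw [hw, EuclideanSpace.inner_single_right, zeroLast_apply]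
    simpa [hm0] using hsc
  refine ⟨c + w, ball_subset_ball' ?_, fun x hx => ?_⟩
  · rw [dist_eq_norm, add_sub_cancel_left, hwn]
    linarith
  · rw [mem_ball, dist_eq_norm] at hx
    have e1 := abs_le.1 (abs_norm_sub_norm_le x (c + w))
    have e2 := abs_le.1 (abs_normPrime_sub_le x (c + w))
    have := norm_nonneg c
    have := normPrime_nonneg c
    constructor <;> linarith

lemma le_muW_ball {m : ℕ} (hm : 1 ≤ m) (θ1 θ2 : ℝ) :
    ∃ K : ℝ, 0 < K ∧ ∀ (c : En (m + 1)) (R : ℝ), 0 < R →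
      ENNReal.ofReal (ballSize (m + 1) θ1 θ2 c R) ≤
        ENNReal.ofReal K * muW (m + 1) θ1 θ2 (ball c R) := by
  obtain ⟨v, hv, hvol⟩ := exists_volume_ball m
  refine ⟨8 ^ (m + 1) * v⁻¹ * 5 ^ |θ1| * 5 ^ |θ2|, by positivity, fun c R hR => ?_⟩
  obtain ⟨y, hsub, hy⟩ := exists_ball_comparable hm c hR
  have hN := normPrime_nonneg c
  have hweight : ∀ x ∈ ball y (R / 8), (normPrime (m + 1) c + R) ^ θ1 * (‖c‖ + R) ^ θ2 ≤
      5 ^ |θ1| * 5 ^ |θ2| * weight (m + 1) θ1 θ2 x := by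
    intro x hx
    obtain ⟨hx1, hx2⟩ := hy x hx
    have hxc := hsub hx
    rw [mem_ball, dist_eq_norm] at hxc
    have hnc := norm_nonneg c
    have e1 := abs_le.1 (abs_norm_sub_norm_le x c)
    have e2 := abs_le.1 (abs_normPrime_sub_le x c)
    have b1 : (normPrime (m + 1) c + R) ^ θ1 ≤ 5 ^ |θ1| * normPrime (m + 1) x ^ θ1 :=
      rpow_le_of_comparable θ1 (by norm_num) (by linarith) (by linarith) (by linarith)
        (by linarith)
    have b2 : (‖c‖ + R) ^ θ2 ≤ 5 ^ |θ2| * ‖x‖ ^ θ2 :=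
      rpow_le_of_comparable θ2 (by norm_num) (by linarith) (by linarith) (by linarith)
        (by linarith)
    calc (normPrime (m + 1) c + R) ^ θ1 * (‖c‖ + R) ^ θ2
        ≤ (5 ^ |θ1| * normPrime (m + 1) x ^ θ1) * (5 ^ |θ2| * ‖x‖ ^ θ2) :=
          mul_le_mul b1 b2 (by positivity) (le_trans (by positivity) b1)
      _ = _ := by rw [weight]; ring
  calc ENNReal.ofReal (ballSize (m + 1) θ1 θ2 c R)
      = ENNReal.ofReal (8 ^ (m + 1) * v⁻¹) * ∫⁻ _x in ball y (R / 8),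
          ENNReal.ofReal ((normPrime (m + 1) c + R) ^ θ1 * (‖c‖ + R) ^ θ2) := by
        rw [setLIntegral_const, hvol y _ (by positivity), ← ENNReal.ofReal_mul (by positivity),
          ← ENNReal.ofReal_mul (by positivity), ballSize, div_pow]
        congr 1
        field_simp
    _ ≤ ENNReal.ofReal (8 ^ (m + 1) * v⁻¹) * ∫⁻ x in ball y (R / 8),
          ENNReal.ofReal (5 ^ |θ1| * 5 ^ |θ2|) * ENNReal.ofReal (weight (m + 1) θ1 θ2 x) := by
        refine mul_le_mul_right (setLIntegral_mono' measurableSet_ball fun x hx => ?_) _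
        rw [← ENNReal.ofReal_mul (by positivity)]
        exact ENNReal.ofReal_le_ofReal (hweight x hx)
    _ = ENNReal.ofReal (8 ^ (m + 1) * v⁻¹ * 5 ^ |θ1| * 5 ^ |θ2|) *
          muW (m + 1) θ1 θ2 (ball y (R / 8)) := by
        rw [lintegral_const_mul' _ _ ENNReal.ofReal_ne_top, ← mul_assoc,
          ← ENNReal.ofReal_mul (by positivity), muW_ball]
        ring_nf
    _ ≤ _ := by gcongr

lemma ballSize_two_mul_le {n : ℕ} (θ1 θ2 : ℝ) (c : En n) {R : ℝ} (hR : 0 < R) :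
    ballSize n θ1 θ2 c (2 * R) ≤ 2 ^ n * 2 ^ |θ1| * 2 ^ |θ2| * ballSize n θ1 θ2 c R := by
  have hN := normPrime_nonneg c
  have hnc := norm_nonneg c
  have e1 : (normPrime n c + 2 * R) ^ θ1 ≤ 2 ^ |θ1| * (normPrime n c + R) ^ θ1 :=
    rpow_le_of_comparable θ1 (by norm_num) (by linarith) (by linarith) (by linarith) (by linarith)
  have e2 : (‖c‖ + 2 * R) ^ θ2 ≤ 2 ^ |θ2| * (‖c‖ + R) ^ θ2 :=
    rpow_le_of_comparable θ2 (by norm_num) (by linarith) (by linarith) (by linarith) (by linarith)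
  calc ballSize n θ1 θ2 c (2 * R)
      = (2 * R) ^ n * (normPrime n c + 2 * R) ^ θ1 * (‖c‖ + 2 * R) ^ θ2 := rfl
    _ ≤ (2 * R) ^ n * (2 ^ |θ1| * (normPrime n c + R) ^ θ1) *
          (2 ^ |θ2| * (‖c‖ + R) ^ θ2) := by gcongr
    _ = _ := by rw [ballSize, mul_pow]; ring

/-- for `(θ1,θ2) ∈ 𝒜 ∪ ℬ`, the measure `dμ = |x'|^θ1 |x|^θ2 dx` is doubling. -/
theorem muW_doubling (n : ℕ) (hn : 2 ≤ n) (θ1 θ2 : ℝ)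
    (hθ : (θ1, θ2) ∈ setA n ∪ setB n) :
    ∃ C : ℝ, 0 < C ∧ ∀ (xbar : En n) (R : ℝ), 0 < R →
      muW n θ1 θ2 (ball xbar (2 * R)) ≤ ENNReal.ofReal C * muW n θ1 θ2 (ball xbar R) := by
  obtain ⟨m, rfl⟩ : ∃ m, n = m + 1 := ⟨n - 1, by omega⟩
  have hm : 1 ≤ m := by omega
  have h1 : -(m : ℝ) < θ1 := by
    rcases hθ with h | h <;> simpa using h.1
  have h2 : 0 ≤ θ2 ∨ -((m : ℝ) + 1) < θ1 + θ2 := by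
    rcases hθ with h | h
    · exact Or.inl h.2
    · exact Or.inr (by simpa using h.2.2)
  obtain ⟨C, hC, upper⟩ := muW_ball_le hm h1 h2
  obtain ⟨K, hK, lower⟩ := le_muW_ball hm θ1 θ2
  set D : ℝ := 2 ^ (m + 1) * 2 ^ |θ1| * 2 ^ |θ2|
  have hD : 0 < D := by positivity
  refine ⟨C * D * K, by positivity, fun c R hR => ?_⟩
  calc muW (m + 1) θ1 θ2 (ball c (2 * R))
      ≤ ENNReal.ofReal (C * ballSize (m + 1) θ1 θ2 c (2 * R)) := upper c _ (by positivity)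
    _ ≤ ENNReal.ofReal (C * D * ballSize (m + 1) θ1 θ2 c R) := by
        rw [mul_assoc]
        gcongr
        exact ballSize_two_mul_le θ1 θ2 c hR
    _ = ENNReal.ofReal (C * D) * ENNReal.ofReal (ballSize (m + 1) θ1 θ2 c R) :=
        ENNReal.ofReal_mul (by positivity)
    _ ≤ ENNReal.ofReal (C * D) *
          (ENNReal.ofReal K * muW (m + 1) θ1 θ2 (ball c R)) := by
        gcongr
        exact lower c R hR
    _ = _ := by rw [ENNReal.ofReal_mul (q := K) (by positivity), mul_assoc]
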